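/- Let f : ℝ → ℝ³ be a C^∞ embedding of period L parametrized by arc length with curvature κ(s) = |f''(s)| > 0 for all s, let P lie outside the curvature tube of f, let r > 0, and set f̃ = I_{P,r}∘f. Assume f̃ has nowhere vanishing curvature, i.e. f̃'(s) × f̃''(s) ≠ 0 for all s. Let n(s) be the unit normal (f(s) − c(s))/ρ(s) at f(s) to the unique sphere Σ(s) containing the osculating circle of f at s and passing through P (with center c(s), radius ρ(s)). Then the torsion of f̃ satisfies τ_{f̃}(s) = −(1/|f̃'(s)|) · f'(s)·(n(s) × n'(s)) for all s. (The right-hand side is unchanged if n is replaced by −n.) -/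

import Mathlib

noncomputable section
open Real

/-- Euclidean 3-space. -/
abbrev E3 : Type := EuclideanSpace ℝ (Fin 3)

/-- The dot product of two vectors in `E3`. -/
def dot3 (u v : E3) : ℝ := u 0 * v 0 + u 1 * v 1 + u 2 * v 2

/-- The cross product of two vectors in `E3`. -/
def cross3 (u v : E3) : E3 :=
  (WithLp.equiv 2 (Fin 3 → ℝ)).symm
    ![u 1 * v 2 - u 2 * v 1, u 2 * v 0 - u 0 * v 2, u 0 * v 1 - u 1 * v 0]

/-- The determinant `det(u, v, w)` of three vectors in `E3`. -/
def det3 (u v w : E3) : ℝ := dot3 u (cross3 v w)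

/-- The writhe of a closed curve `g` of period `L`, given by the Gauss integral. -/
def writhe (g : ℝ → E3) (L : ℝ) : ℝ :=
  (1 / (4 * π)) * ∫ s in (0:ℝ)..L, ∫ t in (0:ℝ)..L,
    det3 (deriv g s) (deriv g t) (g s - g t) / ‖g s - g t‖ ^ 3

/-- The inversion in the sphere of center `P` and radius `r`. -/
def inv3 (P : E3) (r : ℝ) (x : E3) : E3 := P + (r ^ 2 / ‖x - P‖ ^ 2) • (x - P)

/-- The differential of the inversion `inv3 P r` at `x`, applied to `v`. -/
def dInv (P : E3) (r : ℝ) (x v : E3) : E3 :=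
  (r ^ 2 / ‖x - P‖ ^ 2) • (v - ((2 * dot3 (x - P) v) / ‖x - P‖ ^ 2) • (x - P))

/-- The total twist of a closed curve `g` of period `L` with unit normal framing `w`. -/
def twist (g w : ℝ → E3) (L : ℝ) : ℝ :=
  (1 / (2 * π)) * ∫ s in (0:ℝ)..L,
    dot3 (deriv w s) (cross3 ((‖deriv g s‖)⁻¹ • deriv g s) (w s))

/-- The principal normal `e₂ = f''/κ` of an arc-length parametrized curve. -/
def e2 (f : ℝ → E3) (s : ℝ) : E3 := (‖deriv (deriv f) s‖)⁻¹ • deriv (deriv f) s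

/-- The binormal `e₃ = e₁ × e₂` of an arc-length parametrized curve. -/
def e3 (f : ℝ → E3) (s : ℝ) : E3 := cross3 (deriv f s) (e2 f s)

/-- The torsion `τ = e₂'·e₃` of an arc-length parametrized curve. -/
def torsionArc (f : ℝ → E3) (s : ℝ) : ℝ := dot3 (deriv (e2 f) s) (e3 f s)

/-- The total torsion `Tω = (1/2π) ∫ τ` of an arc-length parametrized closed curve. -/
def totalTorsionArc (f : ℝ → E3) (L : ℝ) : ℝ :=
  (1 / (2 * π)) * ∫ s in (0:ℝ)..L, torsionArc f s

/-- The torsion `τ_g = det(g', g'', g''')/|g' × g''|²` of a regular curve. -/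
def torsionGen (g : ℝ → E3) (s : ℝ) : ℝ :=
  det3 (deriv g s) (deriv (deriv g) s) (deriv (deriv (deriv g)) s) /
    ‖cross3 (deriv g s) (deriv (deriv g) s)‖ ^ 2

/-- The total torsion `Tω = (1/2π) ∫ τ_g |g'|` of a regular closed curve. -/
def totalTorsionGen (g : ℝ → E3) (L : ℝ) : ℝ :=
  (1 / (2 * π)) * ∫ s in (0:ℝ)..L, torsionGen g s * ‖deriv g s‖

/-- The osculating circle at `s` of an arc-length parametrized curve with `κ(s) > 0`:
the circle of center `f(s) + (1/κ(s)) e₂(s)` and radius `1/κ(s)` in the plane through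
`f(s)` spanned by `e₁(s)` and `e₂(s)`. -/
def osculatingCircleArc (f : ℝ → E3) (s : ℝ) : Set E3 :=
  {y | (∃ a b : ℝ, y = f s + a • deriv f s + b • e2 f s) ∧
    ‖y - (f s + (‖deriv (deriv f) s‖)⁻¹ • e2 f s)‖ = (‖deriv (deriv f) s‖)⁻¹}

/-- The curvature tube of `f`: the union of all osculating circles. -/
def curvatureTube (f : ℝ → E3) : Set E3 := ⋃ s : ℝ, osculatingCircleArc f s

theorem dot3_eq_inner (u v : E3) : dot3 u v = inner ℝ u v := by
  simp [dot3, PiLp.inner_apply, Fin.sum_univ_three, mul_comm]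

theorem dot3_self (u : E3) : dot3 u u = ‖u‖ ^ 2 := by
  rw [dot3_eq_inner, real_inner_self_eq_norm_sq]

theorem HasDerivAt.dot3 {u v : ℝ → E3} {u' v' : E3} {t : ℝ}
    (hu : HasDerivAt u u' t) (hv : HasDerivAt v v' t) :
    HasDerivAt (fun x => _root_.dot3 (u x) (v x))
      (_root_.dot3 (u t) v' + _root_.dot3 u' (v t)) t := by
  simpa only [dot3_eq_inner] using hu.inner ℝ hv

@[simp] theorem cross3_apply_zero (u v : E3) : cross3 u v 0 = u 1 * v 2 - u 2 * v 1 := rfl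

@[simp] theorem cross3_apply_one (u v : E3) : cross3 u v 1 = u 2 * v 0 - u 0 * v 2 := rfl

@[simp] theorem cross3_apply_two (u v : E3) : cross3 u v 2 = u 0 * v 1 - u 1 * v 0 := rfl

theorem ContDiff.hasDerivAt_deriv {F : Type*} [NormedAddCommGroup F] [NormedSpace ℝ F]
    {g : ℝ → F} (hg : ContDiff ℝ (⊤ : ℕ∞) g) (t : ℝ) : HasDerivAt g (deriv g t) t :=
  (hg.differentiable (by simp) t).hasDerivAt

theorem ContDiff.deriv_top {F : Type*} [NormedAddCommGroup F] [NormedSpace ℝ F]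
    {g : ℝ → F} (hg : ContDiff ℝ (⊤ : ℕ∞) g) : ContDiff ℝ (⊤ : ℕ∞) (deriv g) :=
  (contDiff_infty_iff_deriv.1 hg).2

/-- A vector `h` orthogonal to `T` and `M` is parallel to `T × M`. -/
theorem smul_cross3_eq_of_dot3_eq_zero {T M h : E3} (hT : dot3 h T = 0) (hM : dot3 h M = 0) :
    dot3 h h • cross3 T M = det3 T M h • h := by
  simp only [dot3] at hT hM
  ext i
  fin_cases i <;> simp [det3, dot3]
  · linear_combination (h 1 * M 2 - h 2 * M 1) * hT + (h 2 * T 1 - h 1 * T 2) * hM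
  · linear_combination (h 2 * M 0 - h 0 * M 2) * hT + (h 0 * T 2 - h 2 * T 0) * hM
  · linear_combination (h 0 * M 1 - h 1 * M 0) * hT + (h 1 * T 0 - h 0 * T 1) * hM

/-- The cross product of the first two derivatives of `l • y`, where `l * |y|²` is constant and
`h` is the centre, relative to the curve, of the sphere through its osculating circle and `0`. -/
theorem cross3_deriv_inverted {y T N h : E3} {l l₁ l₂ w σ : ℝ} (hw : dot3 y y = w) (hw0 : w ≠ 0)
    (hl₁ : l₁ * w + l * (2 * dot3 y T) = 0)
    (hl₂ : l₂ * w + 2 * l₁ * (2 * dot3 y T) + l * (2 * (1 + dot3 y N)) = 0)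
    (hyh : 2 * dot3 y h = -w) (hσ : cross3 T (N + (2 / w) • y) = σ • h) :
    cross3 (l₁ • y + l • T) (l₂ • y + l₁ • T + (l₁ • T + l • N)) = -(l ^ 2 * σ) • (h + y) := by
  have e₁ : l₁ = -(l * (2 * dot3 y T)) / w := by field_simp; linarith
  have e₂ : l₂ = -(2 * l₁ * (2 * dot3 y T) + l * (2 * (1 + dot3 y N))) / w := by
    field_simp; linarith
  have triple : w • cross3 T N + dot3 y T • cross3 N y + dot3 y N • cross3 y T
      = det3 y T N • y := by
    rw [← hw]
    ext i
    fin_cases i <;> simp [det3, dot3] <;> ring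
  have vol : det3 y T N = -(σ * w) / 2 := by
    have h₁ : dot3 y (cross3 T (N + (2 / w) • y)) = det3 y T N := by
      simp [det3, dot3]; ring
    have h₂ : dot3 y (σ • h) = σ * dot3 y h := by simp [dot3]; ring
    rw [← h₁, hσ, h₂]
    linear_combination (σ / 2) * hyh
  rw [vol] at triple
  have key : cross3 (l₁ • y + l • T) (l₂ • y + l₁ • T + (l₁ • T + l • N))
      = (2 * l₁ ^ 2 - l * l₂) • cross3 y T + (l * l₁) • cross3 y N + l ^ 2 • cross3 T N := by
    ext i
    fin_cases i <;> simp <;> ring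
  have c₁ : 2 * l₁ ^ 2 - l * l₂ = l ^ 2 * (2 * (1 + dot3 y N)) / w := by
    rw [e₂, e₁]; field_simp; ring
  rw [key, c₁, e₁]
  generalize dot3 y N = q at *
  generalize dot3 y T = p at *
  have expand : ∀ i, cross3 T N i + 2 / w * cross3 T y i = σ * h i := fun i => by
    have := congrArg (fun v : E3 => v i) hσ
    fin_cases i <;> simp at this ⊢ <;> linear_combination this
  ext i
  have hs := expand i
  have ht := congrArg (fun v : E3 => v i) triple
  have hneg : ∀ u v : E3, cross3 u v i = -cross3 v u i := fun u v => by
    fin_cases i <;> simp <;> ring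
  simp only [PiLp.add_apply, PiLp.smul_apply, smul_eq_mul] at ht ⊢
  rw [hneg N y] at ht
  rw [hneg T y] at hs
  generalize cross3 T N i = A at *
  generalize cross3 y N i = B at *
  generalize cross3 y T i = D at *
  field_simp at hs ht ⊢
  linear_combination l ^ 2 * ht - l ^ 2 * hs

/-- The volume spanned by `T`, `h`, `k` when `h` is parallel to `T × (N + (2 / |y|²) y)`. -/
theorem mul_dot3_cross3_eq {y T N h k : E3} {w σ : ℝ} (hTT : dot3 T T = 1)
    (hTN : dot3 T N = 0) (hTk : dot3 T k = -1) (hyk : dot3 y k = -dot3 y T)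
    (hσ : cross3 T (N + (2 / w) • y) = σ • h) :
    σ * dot3 T (cross3 h k) = -dot3 N k := by
  have h₁ : σ * dot3 T (cross3 h k) = dot3 T (cross3 (σ • h) k) := by simp [dot3]; ring
  rw [h₁, ← hσ]
  have h₂ : dot3 T (cross3 (cross3 T (N + (2 / w) • y)) k)
      = (dot3 T N + 2 / w * dot3 y T) * dot3 T k
        - dot3 T T * (dot3 N k + 2 / w * dot3 y k) := by
    simp [dot3]; ring
  rw [h₂, hTT, hTN, hTk, hyk]
  ring

/-- The determinant of the first three derivatives of `l • y`. -/
theorem dot3_third_deriv_inverted {y T N J h k : E3} {l l₁ l₂ l₃ w : ℝ} (hw : dot3 y y = w)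
    (hl₃ : l₃ * w + 3 * l₂ * (2 * dot3 y T) + 3 * l₁ * (2 * (1 + dot3 y N))
      + l * (2 * dot3 y J) = 0)
    (hyh : 2 * dot3 y h = -w) (hTh : dot3 T h = 0) (hNh : dot3 N h = 1)
    (hJh : dot3 N k + dot3 J h = 0) :
    dot3 (l₃ • y + l₂ • T + (l₂ • T + l₁ • N) + (l₂ • T + l₁ • N + (l₁ • N + l • J))) (h + y)
      = -(l * dot3 N k) := by
  have h₁ : dot3 (l₃ • y + l₂ • T + (l₂ • T + l₁ • N) + (l₂ • T + l₁ • N + (l₁ • N + l • J)))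
      (h + y) = l₃ * dot3 y h + 3 * l₂ * dot3 T h + 3 * l₁ * dot3 N h + l * dot3 J h
        + (l₃ * dot3 y y + 3 * l₂ * dot3 y T + 3 * l₁ * dot3 y N + l * dot3 y J) := by
    simp [dot3]; ring
  rw [h₁, hw, hTh, hNh]
  linear_combination (l₃ / 2) * hyh + (1 / 2) * hl₃ + l * hJh

theorem det3_rotate (u v w : E3) : det3 u v w = dot3 w (cross3 u v) := by
  simp [det3, dot3]; ring

/-- Lemma 3. The torsion of the inverted knot `f̃ = I_{P,r} ∘ f` is
the negative of the angular velocity of the unit normal `n(s) = (f(s) − c(s))/ρ(s)`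
to the sphere `Σ(s)`, rescaled by the Jacobian:
`τ_{f̃}(s) = −(1/|f̃'(s)|) · f'(s)·(n(s) × n'(s))`. -/
theorem torsion_of_inverted_knot
    (f : ℝ → E3) (L : ℝ) (hL : 0 < L)
    (hf : ContDiff ℝ (⊤ : ℕ∞) f) (hper : Function.Periodic f L)
    (harc : ∀ s, ‖deriv f s‖ = 1) (hinj : Set.InjOn f (Set.Ico 0 L))
    (hκ : ∀ s, ‖deriv (deriv f) s‖ > 0)
    (P : E3) (hP : P ∉ curvatureTube f) (r : ℝ) (hr : 0 < r)
    (hreg : ∀ s, cross3 (deriv (fun t => inv3 P r (f t)) s)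
        (deriv (deriv (fun t => inv3 P r (f t))) s) ≠ 0)
    (c : ℝ → E3) (ρ μ : ℝ → ℝ)
    (hc : ContDiff ℝ (⊤ : ℕ∞) c) (hμ : ContDiff ℝ (⊤ : ℕ∞) μ)
    (hcdef : ∀ s, c s = f s + (‖deriv (deriv f) s‖)⁻¹ • e2 f s + μ s • e3 f s)
    (hρdef : ∀ s, ρ s = ‖f s - c s‖)
    (hPc : ∀ s, ‖P - c s‖ = ρ s) :
    ∀ s, torsionGen (fun t => inv3 P r (f t)) s
      = -(‖deriv (fun t => inv3 P r (f t)) s‖)⁻¹ *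
          dot3 (deriv f s)
            (cross3 ((ρ s)⁻¹ • (f s - c s))
              (deriv (fun t => (ρ t)⁻¹ • (f t - c t)) s)) := by
  intro s
  set f₁ := deriv f with hf₁
  set f₂ := deriv f₁ with hf₂
  set f₃ := deriv f₂
  have sf₁ : ContDiff ℝ (⊤ : ℕ∞) f₁ := hf.deriv_top
  have sf₂ : ContDiff ℝ (⊤ : ℕ∞) f₂ := sf₁.deriv_top
  have d₀ : ∀ t, HasDerivAt f (f₁ t) t := hf.hasDerivAt_deriv
  have d₁ : ∀ t, HasDerivAt f₁ (f₂ t) t := sf₁.hasDerivAt_deriv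
  have d₂ : ∀ t, HasDerivAt f₂ (f₃ t) t := sf₂.hasDerivAt_deriv
  have hTT : ∀ t, dot3 (f₁ t) (f₁ t) = 1 := fun t => by rw [dot3_self, harc]; norm_num
  have hTN : ∀ t, dot3 (f₁ t) (f₂ t) = 0 := fun t => by
    have := ((d₁ t).dot3 (d₁ t)).unique
      ((hasDerivAt_const t (1 : ℝ)).congr_of_eventuallyEq (.of_forall hTT))
    simp only [dot3] at this ⊢
    linarith
  -- the curve avoids `P`
  have hne : ∀ t, f t - P ≠ 0 := fun t h0 => by
    refine hP (Set.mem_iUnion.2 ⟨t, ⟨⟨0, 0, by simp [sub_eq_zero.1 h0]⟩, ?_⟩⟩)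
    rw [← sub_eq_zero.1 h0]
    have := hκ t
    simp only [e2, sub_add_cancel_left, norm_neg, norm_smul, norm_inv, norm_norm]
    field_simp
  set y : ℝ → E3 := fun t => f t - P with hy
  have dy : ∀ t, HasDerivAt y (f₁ t) t := fun t => (d₀ t).sub_const P
  set w : ℝ → ℝ := fun t => ‖y t‖ ^ 2 with hw
  have hww : ∀ t, dot3 (y t) (y t) = w t := fun t => dot3_self _
  have hw0 : ∀ t, w t ≠ 0 := fun t => by simpa [hw] using hne t
  have sy : ContDiff ℝ (⊤ : ℕ∞) y := hf.sub contDiff_const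
  have sw : ContDiff ℝ (⊤ : ℕ∞) w := sy.norm_sq ℝ
  -- the conformal factor of the inversion
  set l : ℝ → ℝ := fun t => r ^ 2 / w t with hl
  have sl : ContDiff ℝ (⊤ : ℕ∞) l := contDiff_const.div sw hw0
  set l₁ := deriv l
  set l₂ := deriv l₁
  set l₃ := deriv l₂
  have dl : ∀ t, HasDerivAt l (l₁ t) t := sl.hasDerivAt_deriv
  have dl₁ : ∀ t, HasDerivAt l₁ (l₂ t) t := sl.deriv_top.hasDerivAt_deriv
  have dl₂ : ∀ t, HasDerivAt l₂ (l₃ t) t := sl.deriv_top.deriv_top.hasDerivAt_deriv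
  have dw : ∀ t, HasDerivAt w (2 * dot3 (y t) (f₁ t)) t := fun t => by
    refine (((dy t).dot3 (dy t)).congr_of_eventuallyEq
      (.of_forall fun x => (hww x).symm)).congr_deriv ?_
    simp only [dot3]; ring
  have dp : ∀ t, HasDerivAt (fun t => dot3 (y t) (f₁ t)) (1 + dot3 (y t) (f₂ t)) t := fun t =>
    ((dy t).dot3 (d₁ t)).congr_deriv (by rw [hTT, add_comm])
  have dq : ∀ t, HasDerivAt (fun t => dot3 (y t) (f₂ t)) (dot3 (y t) (f₃ t)) t := fun t =>
    ((dy t).dot3 (d₂ t)).congr_deriv (by rw [hTN, add_zero])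
  have rl : ∀ t, l t * w t = r ^ 2 := fun t => div_mul_cancel₀ _ (hw0 t)
  have rl₁ : ∀ t, l₁ t * w t + l t * (2 * dot3 (y t) (f₁ t)) = 0 := fun t =>
    ((dl t).mul (dw t)).unique
      ((hasDerivAt_const t (r ^ 2)).congr_of_eventuallyEq (.of_forall rl))
  have rl₂ : ∀ t, l₂ t * w t + 2 * l₁ t * (2 * dot3 (y t) (f₁ t))
      + l t * (2 * (1 + dot3 (y t) (f₂ t))) = 0 := fun t => by
    have := (((dl₁ t).mul (dw t)).add ((dl t).mul ((dp t).const_mul 2))).unique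
      ((hasDerivAt_const t (0 : ℝ)).congr_of_eventuallyEq (.of_forall rl₁))
    linarith
  have rl₃ : ∀ t, l₃ t * w t + 3 * l₂ t * (2 * dot3 (y t) (f₁ t))
      + 3 * l₁ t * (2 * (1 + dot3 (y t) (f₂ t))) + l t * (2 * dot3 (y t) (f₃ t)) = 0 :=
    fun t => by
    have := ((((dl₂ t).mul (dw t)).add (((dl₁ t).const_mul 2).mul ((dp t).const_mul 2))).add
      ((dl t).mul (((dq t).const_add 1).const_mul 2))).unique
      ((hasDerivAt_const t (0 : ℝ)).congr_of_eventuallyEq (.of_forall rl₂))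
    linarith
  -- derivatives of the inverted curve
  have dg : deriv (fun t => inv3 P r (f t)) = fun t => l₁ t • y t + l t • f₁ t := by
    ext1 t
    exact ((((dl t).smul (dy t)).const_add P).congr_deriv (add_comm _ _)).deriv
  have dg₁ : deriv (fun t => l₁ t • y t + l t • f₁ t)
      = fun t => l₂ t • y t + l₁ t • f₁ t + (l₁ t • f₁ t + l t • f₂ t) := by
    ext1 t
    refine ((((dl₁ t).smul (dy t)).add ((dl t).smul (d₁ t))).congr_deriv ?_).deriv
    abel
  have dg₂ : deriv (fun t => l₂ t • y t + l₁ t • f₁ t + (l₁ t • f₁ t + l t • f₂ t))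
      = fun t => l₃ t • y t + l₂ t • f₁ t + (l₂ t • f₁ t + l₁ t • f₂ t)
        + (l₂ t • f₁ t + l₁ t • f₂ t + (l₁ t • f₂ t + l t • f₃ t)) := by
    ext1 t
    refine (((((dl₂ t).smul (dy t)).add ((dl₁ t).smul (d₁ t))).add
      (((dl₁ t).smul (d₁ t)).add ((dl t).smul (d₂ t)))).congr_deriv ?_).deriv
    abel
  -- the centre of the sphere relative to the curve
  set h : ℝ → E3 := fun t => c t - f t with hh
  set k := deriv h
  have dh : ∀ t, HasDerivAt h (k t) t := (hc.sub hf).hasDerivAt_deriv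
  have hdef : ∀ t, h t = ((‖f₂ t‖)⁻¹ * (‖f₂ t‖)⁻¹) • f₂ t
      + (μ t * (‖f₂ t‖)⁻¹) • cross3 (f₁ t) (f₂ t) := fun t => by
    simp only [hh, hcdef, e2, e3, ← hf₁, ← hf₂]
    ext i
    fin_cases i <;> simp <;> ring
  have hTh : ∀ t, dot3 (f₁ t) (h t) = 0 := fun t => by
    have e : dot3 (f₁ t) (h t) = ((‖f₂ t‖)⁻¹ * (‖f₂ t‖)⁻¹) * dot3 (f₁ t) (f₂ t) := by
      rw [hdef]; simp [dot3]; ring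
    rw [e, hTN, mul_zero]
  have hNh : ∀ t, dot3 (f₂ t) (h t) = 1 := fun t => by
    have e : dot3 (f₂ t) (h t) = ((‖f₂ t‖)⁻¹ * (‖f₂ t‖)⁻¹) * dot3 (f₂ t) (f₂ t) := by
      rw [hdef]; simp [dot3]; ring
    have := hκ t
    rw [e, dot3_self]
    field_simp
  have hρh : ∀ t, ρ t = ‖h t‖ := fun t => by rw [hρdef, norm_sub_rev]
  have hyh : ∀ t, 2 * dot3 (y t) (h t) = -w t := fun t => by
    have e : dot3 (P - c t) (P - c t) = dot3 (h t) (h t) := by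
      rw [dot3_self, dot3_self, hPc, hρh]
    rw [← hww]
    simp only [dot3, hy, hh, PiLp.sub_apply] at e ⊢
    linarith
  have hTk : dot3 (f₁ s) (k s) = -1 := by
    have := ((d₁ s).dot3 (dh s)).unique
      ((hasDerivAt_const s (0 : ℝ)).congr_of_eventuallyEq (.of_forall hTh))
    rw [hNh] at this
    linarith
  have hJh : dot3 (f₂ s) (k s) + dot3 (f₃ s) (h s) = 0 :=
    ((d₂ s).dot3 (dh s)).unique
      ((hasDerivAt_const s (1 : ℝ)).congr_of_eventuallyEq (.of_forall hNh))
  have hyk : dot3 (y s) (k s) = -dot3 (y s) (f₁ s) := by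
    have := (((dy s).dot3 (dh s)).const_mul 2).unique
      ((dw s).neg.congr_of_eventuallyEq (.of_forall hyh))
    rw [hTh] at this
    linarith
  have h0 : h s ≠ 0 := fun h0 => by
    have := hNh s
    simp [h0, dot3] at this
  have hH : dot3 (h s) (h s) ≠ 0 := by
    rw [dot3_self]; simpa using h0
  -- `h` is orthogonal to both `T` and `N + (2 / w) y`
  obtain ⟨σ, hσ⟩ : ∃ σ : ℝ, cross3 (f₁ s) (f₂ s + (2 / w s) • y s) = σ • h s := by
    refine ⟨(dot3 (h s) (h s))⁻¹ * det3 (f₁ s) (f₂ s + (2 / w s) • y s) (h s), ?_⟩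
    rw [mul_smul, ← smul_cross3_eq_of_dot3_eq_zero, smul_smul, inv_mul_cancel₀ hH, one_smul]
    · rw [← hTh s]; simp only [dot3]; ring
    · have e : dot3 (h s) (f₂ s + (2 / w s) • y s)
          = dot3 (f₂ s) (h s) + (1 / w s) * (2 * dot3 (y s) (h s)) := by
        simp [dot3]; ring
      have := hw0 s
      rw [e, hNh, hyh]
      field_simp
      ring
  have hC := cross3_deriv_inverted (hww s) (hw0 s) (rl₁ s) (rl₂ s) (hyh s) hσ
  have hD := mul_dot3_cross3_eq (hTT s) (hTN s) hTk hyk hσ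
  have hE := dot3_third_deriv_inverted (hww s) (rl₃ s) (hyh s) (hTh s) (hNh s) hJh
  have hlpos : 0 < l s := by
    have : 0 < w s := lt_of_le_of_ne (sq_nonneg _) (hw0 s).symm
    simp only [hl]
    positivity
  have hσ0 : σ ≠ 0 := fun h0 => by
    have := hreg s
    rw [dg, dg₁] at this
    exact this (by simp [hC, h0])
  have hspeed : ‖l₁ s • y s + l s • f₁ s‖ = l s := by
    rw [← sq_eq_sq₀ (norm_nonneg _) hlpos.le, ← dot3_self]
    have e : dot3 (l₁ s • y s + l s • f₁ s) (l₁ s • y s + l s • f₁ s)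
        = l₁ s ^ 2 * dot3 (y s) (y s) + 2 * l₁ s * l s * dot3 (y s) (f₁ s)
          + l s ^ 2 * dot3 (f₁ s) (f₁ s) := by
      simp [dot3]; ring
    rw [e, hww, hTT]
    linear_combination l₁ s * rl₁ s
  have hhy : dot3 (h s + y s) (h s + y s) = dot3 (h s) (h s) := by
    have e : dot3 (h s + y s) (h s + y s)
        = dot3 (h s) (h s) + 2 * dot3 (y s) (h s) + dot3 (y s) (y s) := by
      simp [dot3]; ring
    rw [e, hyh, hww]; ring
  -- the angular velocity of the unit normal
  have hn : dot3 (f₁ s) (cross3 ((ρ s)⁻¹ • (f s - c s))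
      (deriv (fun t => (ρ t)⁻¹ • (f t - c t)) s))
      = dot3 (f₁ s) (cross3 (h s) (k s)) / dot3 (h s) (h s) := by
    have dρ : DifferentiableAt ℝ (fun t => (ρ t)⁻¹) s := by
      simp only [hρh]
      exact ((dh s).differentiableAt.norm ℝ h0).inv (norm_ne_zero_iff.2 h0)
    have dfc : HasDerivAt (fun t => f t - c t) (-k s) s :=
      (dh s).neg.congr_of_eventuallyEq (.of_forall fun t => (neg_sub (c t) (f t)).symm)
    have fc : f s - c s = -h s := (neg_sub (c s) (f s)).symm
    have dn : deriv (fun t => (ρ t)⁻¹ • (f t - c t)) s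
        = (ρ s)⁻¹ • (-k s) + deriv (fun t => (ρ t)⁻¹) s • (f s - c s) :=
      (dρ.hasDerivAt.smul dfc).deriv
    rw [dn, fc, dot3_self (h s), ← hρh]
    generalize deriv (fun t => (ρ t)⁻¹) s = a
    simp [dot3]
    ring
  rw [hn, torsionGen, dg, dg₁, dg₂, hspeed, det3_rotate, hC, ← dot3_self]
  have e₁ : ∀ (a : ℝ) (u v : E3), dot3 u (a • v) = a * dot3 u v := fun a u v => by
    simp [dot3]; ring
  have e₂ : ∀ (a : ℝ) (v : E3), dot3 (a • v) (a • v) = a ^ 2 * dot3 v v := fun a v => by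
    simp [dot3]; ring
  rw [e₁, e₂, hhy, hE, ← neg_eq_iff_eq_neg.2 hD]
  have := hlpos.ne'
  field_simp
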